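/- Let K be a group, N a positive integer, and H a subgroup of K of index N. Then the set of group homomorphisms ρ : K → Perm({1, …, N}) such that the induced action of K on {1, …, N} is transitive and {g ∈ K : ρ(g)(1) = 1} = H has exactly (N−1)! elements. -/

import Mathlib

theorem stmt9_stab (N : ℕ) (hN : 0 < N) :
    Nat.card (MulAction.stabilizer (Equiv.Perm (Fin N)) (⟨0, hN⟩ : Fin N)) = (N - 1).factorial := by
  have h := MulAction.index_stabilizer (Equiv.Perm (Fin N)) (⟨0, hN⟩ : Fin N)
  rw [MulAction.orbit_eq_univ, Set.ncard_univ, Nat.card_fin] at h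
  have h2 := (MulAction.stabilizer (Equiv.Perm (Fin N)) (⟨0, hN⟩ : Fin N)).card_mul_index
  rw [h, Nat.card_perm, Nat.card_fin, ← Nat.mul_factorial_pred hN.ne', mul_comm] at h2
  exact Nat.eq_of_mul_eq_mul_left hN h2

theorem stmt9_equiv {α : Type*} (N : ℕ) (hN : 0 < N) (a : α) (e₀ : α ≃ Fin N) :
    Nat.card {e : α ≃ Fin N // e a = ⟨0, hN⟩} = (N - 1).factorial := by
  rw [← stmt9_stab N hN]
  let e₁ : α ≃ Fin N := e₀.trans (Equiv.swap (e₀ a) ⟨0, hN⟩)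
  have h1 : e₁ a = ⟨0, hN⟩ := by simp [e₁]
  have h1' : e₁.symm ⟨0, hN⟩ = a := by rw [← h1]; simp
  refine Nat.card_congr
    { toFun := fun e => ⟨e₁.symm.trans e.1, ?_⟩
      invFun := fun s => ⟨e₁.trans s.1, ?_⟩
      left_inv := ?_
      right_inv := ?_ }
  · rw [MulAction.mem_stabilizer_iff]
    simp [h1', e.2]
  · have := MulAction.mem_stabilizer_iff.1 s.2
    simpa [h1] using this
  · intro e; ext; simp
  · intro s; ext; simp

theorem stmt9 {K : Type*} [Group K] (N : ℕ) (hN : 0 < N) (H : Subgroup K)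
    (hH : H.index = N) :
    Nat.card {ρ : K →* Equiv.Perm (Fin N) //
        (∀ i j : Fin N, ∃ g : K, ρ g i = j) ∧
        {g : K | ρ g ⟨0, hN⟩ = ⟨0, hN⟩} = (H : Set K)} = (N - 1).factorial := by
  have hc : Nat.card (K ⧸ H) = N := hH
  have : Finite (K ⧸ H) := Nat.finite_of_card_ne_zero (by omega)
  rw [← stmt9_equiv N hN ((1 : K) : K ⧸ H) (Finite.equivFinOfCardEq hc)]
  symm
  let F : (K ⧸ H ≃ Fin N) → (K →* Equiv.Perm (Fin N)) := fun e =>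
    (e.permCongrHom.toMonoidHom).comp (MulAction.toPermHom K (K ⧸ H))
  have hF : ∀ e g i, F e g i = e (g • e.symm i) := fun e g i => rfl
  have hF0 : ∀ e : K ⧸ H ≃ Fin N, e ((1 : K) : K ⧸ H) = ⟨0, hN⟩ →
      ∀ g : K, F e g ⟨0, hN⟩ = e (g : K ⧸ H) := by
    intro e he g
    rw [hF, ← he, Equiv.symm_apply_apply, MulAction.Quotient.smul_coe, smul_eq_mul, mul_one]
  refine Nat.card_eq_of_bijective (fun e => ⟨F e.1, ?_, ?_⟩) ⟨?_, ?_⟩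
  · intro i j
    obtain ⟨g, hg⟩ := MulAction.exists_smul_eq K (e.1.symm i) (e.1.symm j)
    exact ⟨g, by rw [hF, hg]; simp⟩
  · ext g
    rw [Set.mem_ofPred_eq, hF0 _ e.2]
    obtain ⟨e, he⟩ := e
    change e (g : K ⧸ H) = _ ↔ _
    rw [← he, e.injective.eq_iff, eq_comm, QuotientGroup.eq]
    simp
  · intro e e' h
    have h' : F e.1 = F e'.1 := congrArg Subtype.val h
    apply Subtype.ext
    apply Equiv.ext
    intro x
    induction x using QuotientGroup.induction_on with
    | H g => rw [← hF0 _ e.2, ← hF0 _ e'.2, h']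
  · rintro ⟨ρ, ht, hs⟩
    have hs' : ∀ g, ρ g ⟨0, hN⟩ = ⟨0, hN⟩ ↔ g ∈ H := fun g => Set.ext_iff.1 hs g
    have key : ∀ a b : K, ρ a ⟨0, hN⟩ = ρ b ⟨0, hN⟩ ↔ a⁻¹ * b ∈ H := by
      intro a b
      rw [← hs', map_mul, map_inv, Equiv.Perm.mul_apply, Equiv.Perm.inv_eq_iff_eq, eq_comm]
    let f : K ⧸ H → Fin N := Quotient.lift (fun g : K => ρ g ⟨0, hN⟩) (by
      intro a b hab
      exact (key a b).2 (QuotientGroup.leftRel_apply.1 hab))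
    have hf : ∀ g : K, f (g : K ⧸ H) = ρ g ⟨0, hN⟩ := fun g => rfl
    have hb : Function.Bijective f := by
      constructor
      · intro x y
        induction x using QuotientGroup.induction_on with
        | H a =>
        induction y using QuotientGroup.induction_on with
        | H b =>
        intro h
        rw [hf, hf, key] at h
        exact QuotientGroup.eq.2 h
      · intro j
        obtain ⟨g, hg⟩ := ht ⟨0, hN⟩ j
        exact ⟨(g : K ⧸ H), hg⟩
    have he : (Equiv.ofBijective f hb) ((1 : K) : K ⧸ H) = ⟨0, hN⟩ := by
      rw [Equiv.ofBijective_apply, hf, map_one, Equiv.Perm.one_apply]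
    refine ⟨⟨Equiv.ofBijective f hb, he⟩, ?_⟩
    apply Subtype.ext
    apply MonoidHom.ext
    intro g
    apply Equiv.ext
    intro i
    obtain ⟨k, rfl⟩ := ht ⟨0, hN⟩ i
    change F (Equiv.ofBijective f hb) g _ = _
    rw [hF, ← hf k]
    have : (Equiv.ofBijective f hb).symm (f (k : K ⧸ H)) = (k : K ⧸ H) :=
      Equiv.ofBijective_symm_apply_apply f hb _
    rw [this, MulAction.Quotient.smul_coe, smul_eq_mul, Equiv.ofBijective_apply, hf, hf, map_mul,
      Equiv.Perm.mul_apply]
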